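/- The linear operator field L(x,y,z) = [[−x,z,y],[−(2/3)y,0,z],[−(1/3)z,0,0]] on ℝ³ is a Nijenhuis operator; the coefficients of its characteristic polynomial are σ₁ = x, σ₂ = yz, σ₃ = (1/3)z³, and these three polynomials are algebraically independent over ℝ. Consequently the algebra with relations η₁⋆η₁ = −η₁, η₁⋆η₂ = −(2/3)η₂, η₁⋆η₃ = −(1/3)η₃, η₂⋆η₃ = η₁, η₃⋆η₂ = η₁, η₃⋆η₃ = η₂ (other products zero) is a differentially non-degenerate LSA. -/

import Mathlib

open Matrix

/-- Components `N^i_{jk}` of the Nijenhuis torsion of a matrix-valued operator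
field `L` on `ℝⁿ` (with `L x i j = L^i_j(x)`). -/
noncomputable def nijTorsion {n : ℕ} (L : (Fin n → ℝ) → Matrix (Fin n) (Fin n) ℝ)
    (x : Fin n → ℝ) (i j k : Fin n) : ℝ :=
  ∑ s : Fin n,
    (L x s j * fderiv ℝ (fun y => L y i k) x (Pi.single s 1)
      - L x s k * fderiv ℝ (fun y => L y i j) x (Pi.single s 1)
      - L x i s * fderiv ℝ (fun y => L y s k) x (Pi.single j 1)
      + L x i s * fderiv ℝ (fun y => L y s j) x (Pi.single k 1))

/-- `L` is a Nijenhuis operator: its Nijenhuis torsion vanishes identically. -/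
def IsNijenhuis {n : ℕ} (L : (Fin n → ℝ) → Matrix (Fin n) (Fin n) ℝ) : Prop :=
  ∀ x i j k, nijTorsion L x i j k = 0

/-- Bilinear product on `ℝⁿ` with structure constants `a i j k`
(`ηᵢ ⋆ ηⱼ = ∑ₖ a i j k • ηₖ`). -/
def mulSC {n : ℕ} (a : Fin n → Fin n → Fin n → ℝ) (ξ η : Fin n → ℝ) : Fin n → ℝ :=
  fun k => ∑ i : Fin n, ∑ j : Fin n, a i j k * ξ i * η j

/-- Left-symmetry: the associator is symmetric in its first two arguments. -/
def IsLSA {n : ℕ} (a : Fin n → Fin n → Fin n → ℝ) : Prop :=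
  ∀ ξ η ζ : Fin n → ℝ,
    mulSC a (mulSC a ξ η) ζ - mulSC a ξ (mulSC a η ζ)
      = mulSC a (mulSC a η ξ) ζ - mulSC a η (mulSC a ξ ζ)

/-- The right-adjoint operator field of the algebra with structure constants `a`:
`(R x) k i = ∑ j, a i j k * x j`, i.e. `(R x).mulVec ξ = ξ ⋆ x`. -/
def rightAdj {n : ℕ} (a : Fin n → Fin n → Fin n → ℝ) (x : Fin n → ℝ) :
    Matrix (Fin n) (Fin n) ℝ :=
  Matrix.of fun k i => ∑ j : Fin n, a i j k * x j

/-- `charCoeff L i` is the coefficient `σ_{i+1}` of `t^(n-1-i)` in the characteristic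
polynomial `χ_{L(x)}(t) = tⁿ + σ₁(x) tⁿ⁻¹ + ⋯ + σₙ(x)` of `L(x)`. -/
noncomputable def charCoeff {n : ℕ} (L : (Fin n → ℝ) → Matrix (Fin n) (Fin n) ℝ)
    (i : Fin n) : (Fin n → ℝ) → ℝ :=
  fun x => (L x).charpoly.coeff (n - 1 - (i : ℕ))

/-- A (structure-constant) algebra is differentially non-degenerate if the coefficients
of the characteristic polynomial of its right-adjoint operator are algebraically
independent over `ℝ` (as elements of the algebra of real-valued functions). -/
def DiffNonDeg {n : ℕ} (a : Fin n → Fin n → Fin n → ℝ) : Prop :=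
  AlgebraicIndependent ℝ (charCoeff (rightAdj a))

/-- Isomorphism of the algebras on `ℝⁿ` with structure constants `a` and `b`. -/
def AlgIsoSC {n : ℕ} (a b : Fin n → Fin n → Fin n → ℝ) : Prop :=
  ∃ φ : (Fin n → ℝ) ≃ₗ[ℝ] (Fin n → ℝ),
    ∀ ξ η : Fin n → ℝ, φ (mulSC a ξ η) = mulSC b (φ ξ) (φ η)

/-- Jacobi matrix of a family of functions `σ` on `ℝⁿ`: `J i j = ∂σᵢ/∂xⱼ`. -/
noncomputable def jacobiMat {n : ℕ} (σ : Fin n → (Fin n → ℝ) → ℝ) (x : Fin n → ℝ) :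
    Matrix (Fin n) (Fin n) ℝ :=
  Matrix.of fun i j => fderiv ℝ (σ i) x (Pi.single j 1)

/-- Companion-type matrix with first column `(-s 0, …, -s (n-1))ᵀ`, ones on the
superdiagonal and zeros elsewhere. -/
def companionS {n : ℕ} (s : Fin n → ℝ) : Matrix (Fin n) (Fin n) ℝ :=
  Matrix.of fun i j => if (j : ℕ) = 0 then -s i else if (j : ℕ) = (i : ℕ) + 1 then 1 else 0

/-- The operator field of the fourth indecomposable algebra. -/
noncomputable def Lop (x : Fin 3 → ℝ) : Matrix (Fin 3) (Fin 3) ℝ :=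
  Matrix.of ![![-x 0, x 2, x 1], ![-(2 / 3) * x 1, 0, x 2], ![-(1 / 3) * x 2, 0, 0]]

/-- Structure constants of the fourth indecomposable algebra. -/
noncomputable def sc : Fin 3 → Fin 3 → Fin 3 → ℝ :=
  ![![![-1,0,0], ![0,-(2/3),0], ![0,0,-(1/3)]],
    ![![0,0,0], ![0,0,0], ![1,0,0]],
    ![![0,0,0], ![1,0,0], ![0,1,0]]]

theorem algebraicIndependent_of_box {ι X R : Type*} [CommRing R] [IsDomain R]
    (f : ι → X → R) (s : ι → Set R) (hs : ∀ i, (s i).Infinite)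
    (h : ∀ c ∈ Set.pi Set.univ s, ∃ x, ∀ i, f i x = c i) :
    AlgebraicIndependent R f := by
  rw [algebraicIndependent_iff]
  intro p hp
  refine MvPolynomial.funext_set s hs fun c hc => ?_
  obtain ⟨x, hx⟩ := h c hc
  have hpx : Pi.evalAlgHom R (fun _ : X => R) x (MvPolynomial.aeval f p) = 0 := by
    rw [hp, map_zero]
  have hfc : (fun i => Pi.evalAlgHom R (fun _ : X => R) x (f i)) = c := funext hx
  rw [← AlgHom.comp_apply, MvPolynomial.comp_aeval, hfc] at hpx
  rw [map_zero, ← hpx, MvPolynomial.aeval_eq_eval]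

theorem fderiv_rightAdj_single {n : ℕ} (a : Fin n → Fin n → Fin n → ℝ) (x : Fin n → ℝ)
    (k i s : Fin n) :
    fderiv ℝ (fun y => rightAdj a y k i) x (Pi.single s 1) = a i s k := by
  have h : HasFDerivAt (fun y => rightAdj a y k i)
      (∑ j, a i j k • ContinuousLinearMap.proj (R := ℝ) (φ := fun _ : Fin n => ℝ) j) x := by
    simp only [rightAdj, Matrix.of_apply]
    exact HasFDerivAt.fun_sum fun j _ => (hasFDerivAt_apply j x).const_mul (a i j k)
  rw [h.fderiv]
  simp [Pi.single_apply]

theorem rightAdj_sc : rightAdj sc = Lop := by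
  funext x
  ext i j
  fin_cases i <;> fin_cases j <;> simp [rightAdj, sc, Lop, Fin.sum_univ_three]

theorem isNijenhuis_Lop : IsNijenhuis Lop := by
  intro x i j k
  rw [← rightAdj_sc]
  simp only [nijTorsion, fderiv_rightAdj_single]
  rw [rightAdj_sc]
  fin_cases i <;> fin_cases j <;> fin_cases k <;>
    simp [sc, Lop, Fin.sum_univ_three] <;> ring

theorem isLSA_sc : IsLSA sc := by
  intro ξ η ζ
  funext k
  fin_cases k <;> simp [mulSC, sc, Fin.sum_univ_three] <;> ring

open Polynomial in
theorem charpoly_Lop (x : Fin 3 → ℝ) :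
    (Lop x).charpoly = X ^ 3 + C (x 0) * X ^ 2 + C (x 1 * x 2) * X + C ((1 / 3) * x 2 ^ 3) := by
  have h : C (2 / 3 : ℝ) = 2 * C (1 / 3) := by rw [← C_ofNat, ← C_mul]; norm_num
  have h' : (3 : ℝ[X]) * C (1 / 3) = 1 := by rw [← C_ofNat, ← C_mul]; norm_num
  rw [Matrix.charpoly, Matrix.det_fin_three]
  simp only [Matrix.charmatrix_apply, Lop]
  simp [-one_div, h]
  linear_combination C (x 1) * C (x 2) * X * h'

theorem charCoeff_Lop (x : Fin 3 → ℝ) :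
    charCoeff Lop 0 x = x 0 ∧ charCoeff Lop 1 x = x 1 * x 2 ∧
      charCoeff Lop 2 x = (1 / 3) * x 2 ^ 3 := by
  simp [charCoeff, charpoly_Lop, Polynomial.coeff_X, Polynomial.coeff_C, Polynomial.coeff_X_pow,
    -map_mul, -one_div]

theorem algebraicIndependent_coeffs :
    AlgebraicIndependent ℝ
      ![(fun x : Fin 3 → ℝ => x 0),
        (fun x : Fin 3 → ℝ => x 1 * x 2),
        (fun x : Fin 3 → ℝ => (1 / 3) * x 2 ^ 3)] := by
  refine algebraicIndependent_of_box _ (fun _ => Set.Ioi 0) (fun _ => Set.Ioi_infinite 0)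
    fun c hc => ?_
  have hc2 : 0 < 3 * c 2 := mul_pos three_pos (hc 2 trivial)
  obtain ⟨z, hz, hz3⟩ : ∃ z : ℝ, 0 < z ∧ z ^ 3 = 3 * c 2 :=
    ⟨(3 * c 2) ^ ((3 : ℕ) : ℝ)⁻¹, Real.rpow_pos_of_pos hc2 _,
      Real.rpow_inv_natCast_pow hc2.le three_ne_zero⟩
  refine ⟨![c 0, c 1 / z, z], fun i => ?_⟩
  fin_cases i
  · simp
  · simp [hz.ne']
  · simp [hz3]

theorem charCoeff_Lop_eq :
    charCoeff Lop =
      ![(fun x : Fin 3 → ℝ => x 0),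
        (fun x : Fin 3 → ℝ => x 1 * x 2),
        (fun x : Fin 3 → ℝ => (1 / 3) * x 2 ^ 3)] := by
  funext i x
  obtain ⟨h0, h1, h2⟩ := charCoeff_Lop x
  fin_cases i
  exacts [h0, h1, h2]

/-- The operator field is a Nijenhuis operator; the coefficients of its
characteristic polynomial are the stated polynomials, which are algebraically
independent over `ℝ`; it is the right-adjoint operator of the stated algebra,
which is consequently a differentially non-degenerate LSA. -/
theorem stmt15 :
    IsNijenhuis Lop ∧
    (∀ x : Fin 3 → ℝ, charCoeff Lop 0 x = x 0) ∧
    (∀ x : Fin 3 → ℝ, charCoeff Lop 1 x = x 1 * x 2) ∧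
    (∀ x : Fin 3 → ℝ, charCoeff Lop 2 x = (1 / 3) * x 2 ^ 3) ∧
    AlgebraicIndependent ℝ
      ![(fun x : Fin 3 → ℝ => x 0),
        (fun x : Fin 3 → ℝ => x 1 * x 2),
        (fun x : Fin 3 → ℝ => (1 / 3) * x 2 ^ 3)] ∧
    rightAdj sc = Lop ∧ IsLSA sc ∧ DiffNonDeg sc :=
  ⟨isNijenhuis_Lop, fun x => (charCoeff_Lop x).1, fun x => (charCoeff_Lop x).2.1,
    fun x => (charCoeff_Lop x).2.2, algebraicIndependent_coeffs, rightAdj_sc, isLSA_sc, by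
      rw [DiffNonDeg, rightAdj_sc, charCoeff_Lop_eq]
      exact algebraicIndependent_coeffs⟩
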